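/- arXiv:math/0312313 — 2 statements merged into one kernel-verified Lean document; each statement's English description precedes it below -/
import Mathlib

section
/- (Goddard's uniqueness theorem.) Let 1∈E be an even vector, 𝐓=(T,T̄) an even pair of operators on E, and F a graded subspace of End(E)-valued distributions consisting of homogeneous elements such that F is creative (every element of F is creative for 1 and 𝐓), complete (s_1F = E), and local (any two homogeneous elements of F are local). Then s_1 : F → E, a(𝐳) ↦ a_{(−1,−1)}1, is a linear isomorphism. -/
open scoped BigOperators Classical

noncomputable section

namespace OPEA

variable (K : Type*) [Field K] [CharZero K]

/-- index pairs 𝐧 = (n, n̄) ∈ K² -/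
abbrev Idx := K × K

def IsInt (x : K) : Prop := ∃ k : ℤ, (k : K) = x

def IsNegInt (x : K) : Prop := ∃ k : ℤ, k < 0 ∧ (k : K) = x

/-- 𝕂̄ = {𝐧 ∈ K² | n − n̄ ∈ ℤ} -/
def Kbar (n : Idx K) : Prop := IsInt K (n.1 - n.2)

def IsIntPair (n : Idx K) : Prop := IsInt K n.1 ∧ IsInt K n.2

/-- generalized binomial coefficient C(x,k) -/
def gchoose (x : K) (k : ℕ) : K :=
  (∏ i ∈ Finset.range k, (x - (i : K))) / (k.factorial : K)

/-- (−1)^x for x an integer image in K (and 1 otherwise) -/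
def negOnePow (x : K) : K :=
  if h : ∃ k : ℤ, (k : K) = x then (-1 : K) ^ h.choose else 1

variable (M : Type*) [AddCommGroup M] [Module K M]

/-- M-valued distribution in one variable pair -/
abbrev Dist1 := Idx K → M

/-- M-valued distribution in two variable pairs -/
abbrev Dist2 := Idx K → Idx K → M

/-- M-valued distribution in r variable pairs -/
abbrev DistN (r : ℕ) := (Fin r → Idx K) → M

/-- membership in M[[𝐳]] -/
def IsPow1 (a : Dist1 K M) : Prop := ∀ n, a n ≠ 0 → IsNegInt K n.1 ∧ IsNegInt K n.2

/-- membership in M⌊𝐳⌋ -/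
def InLat1 (a : Dist1 K M) : Prop :=
  ∃ S : Finset (Idx K), ∀ n, a n ≠ 0 →
    ∃ m ∈ S, IsNegInt K (n.1 - m.1) ∧ IsNegInt K (n.2 - m.2)

/-- membership in M[[𝐳,𝐰]] -/
def IsPow2 (a : Dist2 K M) : Prop :=
  ∀ n k, a n k ≠ 0 →
    (IsNegInt K n.1 ∧ IsNegInt K n.2) ∧ (IsNegInt K k.1 ∧ IsNegInt K k.2)

/-- membership in M⌊𝐳,𝐰⌋ -/
def InLat2 (a : Dist2 K M) : Prop :=
  ∃ S : Finset (Idx K × Idx K), ∀ n k, a n k ≠ 0 →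
    ∃ m ∈ S, (IsNegInt K (n.1 - m.1.1) ∧ IsNegInt K (n.2 - m.1.2)) ∧
      (IsNegInt K (k.1 - m.2.1) ∧ IsNegInt K (k.2 - m.2.2))

/-- membership in M[[𝐳₁,…,𝐳ᵣ]] -/
def IsPowN {r : ℕ} (a : DistN K M r) : Prop :=
  ∀ n, a n ≠ 0 → ∀ i, IsNegInt K (n i).1 ∧ IsNegInt K (n i).2

/-- membership in M⌊𝐳₁,…,𝐳ᵣ⌋ -/
def InLatN {r : ℕ} (a : DistN K M r) : Prop :=
  ∃ S : Finset (Fin r → Idx K), ∀ n, a n ≠ 0 →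
    ∃ m ∈ S, ∀ i, IsNegInt K ((n i).1 - (m i).1) ∧ IsNegInt K ((n i).2 - (m i).2)

/-- ∂_z -/
def dz (a : Dist1 K M) : Dist1 K M := fun n => (-n.1) • a (n.1 - 1, n.2)

/-- ∂_z̄ -/
def dzb (a : Dist1 K M) : Dist1 K M := fun n => (-n.2) • a (n.1, n.2 - 1)

/-- ∂ in the first variable pair of a two-variable distribution (z-component) -/
def d1z (c : Dist2 K M) : Dist2 K M := fun n k => (-n.1) • c (n.1 - 1, n.2) k

/-- ∂ in the first variable pair of a two-variable distribution (z̄-component) -/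
def d1zb (c : Dist2 K M) : Dist2 K M := fun n k => (-n.2) • c (n.1, n.2 - 1) k

/-- divided power d^{(x)} of an operator d, for a K-valued exponent x
(zero unless x ∈ ℕ) -/
def dPow {A : Type*} [AddCommGroup A] [Module K A] (d : A → A) (x : K) (a : A) : A :=
  if h : ∃ j : ℕ, (j : K) = x then ((h.choose.factorial : K))⁻¹ • d^[h.choose] a else 0

/-- ∂_z^{(e_1)} ∂_z̄^{(e_2)} in the first variable pair -/
def ddPow2 (e : Idx K) (c : Dist2 K M) : Dist2 K M :=
  dPow K (d1z K M) e.1 (dPow K (d1zb K M) e.2 c)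

/-- the diagonal map c(𝐳,𝐰) ↦ c(𝐰,𝐰) -/
def diag (c : Dist2 K M) : Dist1 K M :=
  fun n => ∑ᶠ m : Idx K, c m (n.1 - m.1 - 1, n.2 - m.2 - 1)

/-- multiplication by (𝐳−𝐰)^h (expansion in z>w), on coefficients;
first index is 𝐳, second is 𝐰 -/
def zwPow (h : Idx K) (c : Dist2 K M) : Dist2 K M :=
  fun m k => ∑ᶠ i : ℕ × ℕ,
    ((-1 : K) ^ (i.1 + i.2) * gchoose K h.1 i.1 * gchoose K h.2 i.2) •
      c (m.1 + h.1 - i.1, m.2 + h.2 - i.2) (k.1 + i.1, k.2 + i.2)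

/-- multiplication by ((𝐳−𝐰)_{w>z})^h = (−1)^h (𝐰−𝐳)^h (expansion in w>z) -/
def zwPowW (h : Idx K) (c : Dist2 K M) : Dist2 K M :=
  fun m k => ∑ᶠ i : ℕ × ℕ,
    (negOnePow K (h.1 - h.2) * (-1 : K) ^ (i.1 + i.2) *
        gchoose K h.1 i.1 * gchoose K h.2 i.2) •
      c (m.1 + i.1, m.2 + i.2) (k.1 + h.1 - i.1, k.2 + h.2 - i.2)

/-- multiplication by (𝐱+𝐰)^N of a distribution d(𝐰,𝐱) (first index 𝐰, second 𝐱);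
the result is indexed by (x-index, w-index) -/
def xwPow (N : Idx K) (d : Dist2 K M) : Dist2 K M :=
  fun m k => ∑ᶠ i : ℕ × ℕ, (gchoose K N.1 i.1 * gchoose K N.2 i.2) •
    d (k.1 + i.1, k.2 + i.2) (m.1 + N.1 - i.1, m.2 + N.2 - i.2)

/-- multiplication by (𝐰+𝐱)^N of a distribution d(𝐰,𝐱) (first index 𝐰, second 𝐱);
the result is indexed by (x-index, w-index) -/
def wxPow (N : Idx K) (d : Dist2 K M) : Dist2 K M :=
  fun m k => ∑ᶠ i : ℕ × ℕ, (gchoose K N.1 i.1 * gchoose K N.2 i.2) •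
    d (k.1 + N.1 - i.1, k.2 + N.2 - i.2) (m.1 + i.1, m.2 + i.2)

/-- multiplication by 𝐱^A 𝐰^B (𝐱+𝐰)^N of p(𝐰,𝐱); result indexed (x-index, w-index) -/
def tripleXW (A B N : Idx K) (p : Dist2 K M) : Dist2 K M :=
  fun m k => ∑ᶠ l : ℕ × ℕ, (gchoose K N.1 l.1 * gchoose K N.2 l.2) •
    p (k.1 + B.1 + l.1, k.2 + B.2 + l.2) (m.1 + A.1 + N.1 - l.1, m.2 + A.2 + N.2 - l.2)

/-- multiplication by 𝐱^A 𝐰^B (𝐰+𝐱)^N of p(𝐰,𝐱); result indexed (x-index, w-index) -/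
def tripleWX (A B N : Idx K) (p : Dist2 K M) : Dist2 K M :=
  fun m k => ∑ᶠ l : ℕ × ℕ, (gchoose K N.1 l.1 * gchoose K N.2 l.2) •
    p (k.1 + B.1 + N.1 - l.1, k.2 + B.2 + N.2 - l.2) (m.1 + A.1 + l.1, m.2 + A.2 + l.2)

variable (E : Type*) [AddCommGroup E] [Module K E]

/-- End(E)-valued distributions in one variable pair -/
abbrev EDist1 := Dist1 K (Module.End K E)

/-- End(E)-valued distributions in two variable pairs -/
abbrev EDist2 := Dist2 K (Module.End K E)

/-- End(E)-valued distributions in r variable pairs -/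
abbrev EDistN (r : ℕ) := DistN K (Module.End K E) r

def ev1 (a : EDist1 K E) (v : E) : Dist1 K E := fun n => a n v

def ev2 (c : EDist2 K E) (v : E) : Dist2 K E := fun n k => c n k v

def evN {r : ℕ} (c : EDistN K E r) (v : E) : DistN K E r := fun n => c n v

/-- a(𝐳) is a field -/
def IsFieldD (a : EDist1 K E) : Prop := ∀ v, InLat1 K E (ev1 K E a v)

/-- a field in two variable pairs -/
def IsField2D (c : EDist2 K E) : Prop := ∀ v, InLat2 K E (ev2 K E c v)

/-- the Koszul sign (−1)^{pq} -/
def koszul (p q : ZMod 2) : K := if p = 1 ∧ q = 1 then (-1 : K) else 1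

/-- the data (c^i, 𝐡_i) is an OPE of the homogeneous distributions a(𝐳), b(𝐳)
of parities pa, pb (all identities to be read applied to each vector of E) -/
def IsOPE (pa pb : ZMod 2) (a b : EDist1 K E) {r : ℕ}
    (c : Fin r → EDist2 K E) (h : Fin r → Idx K) : Prop :=
  (∀ i, Kbar K (h i)) ∧ (∀ i, IsField2D K E (c i)) ∧
  (∀ v m k, a m (b k v) = ∑ i, zwPow K E (-(h i)) (ev2 K E (c i) v) m k) ∧
  (∀ v m k, koszul K pa pb • (b k (a m v)) =
      ∑ i, zwPowW K E (-(h i)) (ev2 K E (c i) v) m k)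

/-- a(𝐳), b(𝐳) (homogeneous of parities pa, pb) are local -/
def IsLocal (pa pb : ZMod 2) (a b : EDist1 K E) : Prop :=
  ∃ (r : ℕ) (c : Fin r → EDist2 K E) (h : Fin r → Idx K), IsOPE K E pa pb a b c h

/-- the exponents of an OPE are reduced: 𝐡_i ∉ 𝐡_j + ℤ² for i ≠ j -/
def ReducedExp {r : ℕ} (h : Fin r → Idx K) : Prop :=
  ∀ i j, i ≠ j → ¬ IsIntPair K (h i - h j)

/-- the product field a(𝐰)_{(𝐧)}b(𝐰) built from an OPE (c,h), applied to a vector v -/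
def prodAt {r : ℕ} (c : Fin r → EDist2 K E) (h : Fin r → Idx K) (n : Idx K)
    (v : E) : Dist1 K E :=
  fun m => ∑ i, diag K E
    (ddPow2 K E ((h i).1 - 1 - n.1, (h i).2 - 1 - n.2) (ev2 K E (c i) v)) m

/-- s₁ : a(𝐳) ↦ a_{(−1,−1)}1 -/
def s1 (one : E) (a : EDist1 K E) : E := a ((-1 : K), (-1 : K)) one

/-- the distribution d (to be thought of as a(𝐳)1) equals
Σ_{𝐢∈ℕ²} T^{(i)} T̄^{(ī)} (d_{(−1,−1)}) 𝐳^𝐢, i.e. a(𝐳) is creative -/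
def CreativeD (T Tb : Module.End K E) (d : Dist1 K E) : Prop :=
  (∀ i : ℕ × ℕ, d (-(i.1 : K) - 1, -(i.2 : K) - 1) =
      ((i.1.factorial : K)⁻¹ * (i.2.factorial : K)⁻¹) •
        ((T ^ i.1) * (Tb ^ i.2)) (d ((-1 : K), (-1 : K)))) ∧
  (∀ n : Idx K, (¬ ∃ i : ℕ × ℕ, n = (-(i.1 : K) - 1, -(i.2 : K) - 1)) → d n = 0)

/-- a(𝐳) is translation covariant for (T, T̄) -/
def TransCov (T Tb : Module.End K E) (a : EDist1 K E) : Prop :=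
  (∀ n : Idx K, T * a n - a n * T = (-n.1) • a (n.1 - 1, n.2)) ∧
  (∀ n : Idx K, Tb * a n - a n * Tb = (-n.2) • a (n.1, n.2 - 1))

/-- translation covariance of a product field, per vector -/
def TransCovAt (T Tb : Module.End K E) (P : E → Dist1 K E) : Prop :=
  (∀ v (m : Idx K), T (P v m) - P (T v) m = (-m.1) • P v (m.1 - 1, m.2)) ∧
  (∀ v (m : Idx K), Tb (P v m) - P (Tb v) m = (-m.2) • P v (m.1, m.2 - 1))

/-- the identity field 1(z) = id_E -/
def idField : EDist1 K E :=
  fun n => if n = ((-1 : K), (-1 : K)) then (1 : Module.End K E) else 0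

/-- pairs i < j in [r] -/
abbrev Pairs (r : ℕ) := {p : Fin r × Fin r // p.1 < p.2}

/-- the index shift of the i-th variable produced by the monomial of a binomial
expansion of ((𝐳_{p₁} − 𝐳_{p₂})_σ)^h belonging to 𝐤 ∈ ℕ² -/
def pairShift {r : ℕ} (p : Pairs r) (h : Idx K) (flip : Bool) (kk : ℕ × ℕ)
    (i : Fin r) : Idx K :=
  if i = p.1.1 then
    (if flip then ((kk.1 : K), (kk.2 : K)) else (h.1 - kk.1, h.2 - kk.2))
  else if i = p.1.2 then
    (if flip then (h.1 - kk.1, h.2 - kk.2) else ((kk.1 : K), (kk.2 : K)))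
  else 0

/-- the coefficient of a binomial expansion of ((𝐳_{p₁} − 𝐳_{p₂})_σ)^h
belonging to 𝐤 ∈ ℕ² -/
def pairCoef (h : Idx K) (flip : Bool) (kk : ℕ × ℕ) : K :=
  (if flip then negOnePow K (h.1 - h.2) else 1) * (-1 : K) ^ (kk.1 + kk.2) *
    gchoose K h.1 kk.1 * gchoose K h.2 kk.2

def flipOf {r : ℕ} (σ : Equiv.Perm (Fin r)) (p : Pairs r) : Bool :=
  decide (σ.symm p.1.2 < σ.symm p.1.1)

/-- multiplication by Π_{i<j} ((𝐳_i − 𝐳_j)_σ)^{h_{ij}} on an r-variable distribution -/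
def permMul {r : ℕ} (σ : Equiv.Perm (Fin r)) (hs : Pairs r → Idx K)
    (c : DistN K M r) : DistN K M r :=
  fun m => ∑ᶠ κ : Pairs r → ℕ × ℕ,
    (∏ p : Pairs r, pairCoef K (hs p) (flipOf σ p) (κ p)) •
      c (fun i => m i + ∑ p : Pairs r, pairShift K p (hs p) (flipOf σ p) (κ p) i)

/-- the Koszul sign ζ' produced by reordering a¹,…,aʳ into a^{σ1},…,a^{σr} -/
def koszulPerm {r : ℕ} (ps : Fin r → ZMod 2) (σ : Equiv.Perm (Fin r)) : K :=
  ∏ p : Pairs r,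
    if σ.symm p.1.2 < σ.symm p.1.1 ∧ ps p.1.1 = 1 ∧ ps p.1.2 = 1 then (-1 : K) else 1

/-- the composition a^{σ1}(𝐳_{σ1})_{m_{σ1}} ∘ ⋯ ∘ a^{σr}(𝐳_{σr})_{m_{σr}} applied to v -/
def compSeq {r : ℕ} (a : Fin r → EDist1 K E) (σ : Equiv.Perm (Fin r))
    (m : Fin r → Idx K) (v : E) : E :=
  (List.ofFn fun j : Fin r => σ j).foldr (fun i acc => a i (m i) acc) v

/-- the data (c^α, 𝐡_{ij}^k) is a (multiple) OPE of the homogeneous distributions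
a¹(𝐳),…,aʳ(𝐳) of parities ps -/
def IsMultOPE {r : ℕ} (a : Fin r → EDist1 K E) (ps : Fin r → ZMod 2)
    (rij : Fin r → Fin r → ℕ) (hs : ∀ i j : Fin r, Fin (rij i j) → Idx K)
    (c : ((p : Pairs r) → Fin (rij p.1.1 p.1.2)) → EDistN K E r) : Prop :=
  (∀ i j k, Kbar K (hs i j k)) ∧
  (∀ α v, InLatN K E (evN K E (c α) v)) ∧
  (∀ σ : Equiv.Perm (Fin r), ∀ v m,
    koszulPerm K ps σ • compSeq K E a σ m v =
      ∑ α : (p : Pairs r) → Fin (rij p.1.1 p.1.2),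
        permMul K E σ (fun p => -(hs p.1.1 p.1.2 (α p))) (evN K E (c α) v) m)

/-- a¹(𝐳),…,aʳ(𝐳) are multiply local -/
def MultiplyLocal {r : ℕ} (a : Fin r → EDist1 K E) (ps : Fin r → ZMod 2) : Prop :=
  ∃ (rij : Fin r → Fin r → ℕ) (hs : ∀ i j : Fin r, Fin (rij i j) → Idx K)
    (c : ((p : Pairs r) → Fin (rij p.1.1 p.1.2)) → EDistN K E r),
      IsMultOPE K E a ps rij hs c

/-- a set of homogeneous fields (with parities pF) is multiply local -/
def MultLocalSet (F : Set (EDist1 K E)) (pF : EDist1 K E → ZMod 2) : Prop :=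
  ∀ (r : ℕ) (f : Fin r → EDist1 K E), (∀ i, f i ∈ F) →
    MultiplyLocal K E f (fun i => pF (f i))

/-- a set of homogeneous fields (with parities pF) is uniformly local -/
def UnifLocalSet (F : Set (EDist1 K E)) (pF : EDist1 K E → ZMod 2) (one : E) : Prop :=
  ∃ (rr : EDist1 K E → EDist1 K E → ℕ)
    (hh : ∀ d e : EDist1 K E, Fin (rr d e) → Idx K),
    ∀ (r : ℕ) (f : Fin r → EDist1 K E), (∀ i, f i ∈ F) →
      ∃ c, IsMultOPE K E f (fun i => pF (f i)) (fun i j => rr (f i) (f j))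
          (fun i j => hh (f i) (f j)) c ∧
        ∀ α, IsPowN K E (evN K E (c α) one)

/-- a ∈ V is homogeneous of parity p w.r.t. the grading (ev, od) -/
def memPar {V : Type*} [AddCommGroup V] [Module K V] (ev od : Submodule K V)
    (a : V) (p : ZMod 2) : Prop :=
  (p = 0 ∧ a ∈ ev) ∨ (p = 1 ∧ a ∈ od)

/-- an endomorphism is homogeneous of parity p w.r.t. the grading (ev, od) -/
def EndPar {V : Type*} [AddCommGroup V] [Module K V] (ev od : Submodule K V)
    (f : Module.End K V) (p : ZMod 2) : Prop :=
  if p = 0 then (∀ v ∈ ev, f v ∈ ev) ∧ (∀ v ∈ od, f v ∈ od)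
  else (∀ v ∈ ev, f v ∈ od) ∧ (∀ v ∈ od, f v ∈ ev)

/-- a distribution is homogeneous of parity p -/
def EDistPar {V : Type*} [AddCommGroup V] [Module K V] (ev od : Submodule K V)
    (a : EDist1 K V) (p : ZMod 2) : Prop :=
  ∀ n, EndPar K ev od (a n) p

end OPEA

namespace OPEA

/-- an OPE-algebra -/
structure OPEAlg (K : Type*) [Field K] [CharZero K]
    (V : Type*) [AddCommGroup V] [Module K V] where
  ev : Submodule K V
  od : Submodule K V
  compl : IsCompl ev od
  Y : V →ₗ[K] EDist1 K V
  Y_par : ∀ a p, memPar K ev od a p → ∀ (n : Idx K) b q, memPar K ev od b q →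
    memPar K ev od (Y a n b) (p + q)
  one : V
  one_ev : one ∈ ev
  T : Module.End K V
  Tb : Module.End K V
  T_ev : EndPar K ev od T 0
  Tb_ev : EndPar K ev od Tb 0
  commTTb : T * Tb = Tb * T
  T_one : T one = 0
  Tb_one : Tb one = 0
  wcre : ∀ a, IsPow1 K V (ev1 K V (Y a) one)
  rid : ∀ a, Y a ((-1 : K), (-1 : K)) one = a
  tcov : ∀ a, TransCov K V T Tb (Y a)
  loc : ∀ a b pa pb, memPar K ev od a pa → memPar K ev od b pb →
    IsLocal K V pa pb (Y a) (Y b)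

/-- a bounded 𝕂̄-fold algebra -/
structure BFold (K : Type*) [Field K] [CharZero K]
    (V : Type*) [AddCommGroup V] [Module K V] where
  ev : Submodule K V
  od : Submodule K V
  compl : IsCompl ev od
  Y : V →ₗ[K] EDist1 K V
  Y_par : ∀ a p, memPar K ev od a p → ∀ (n : Idx K) b q, memPar K ev od b q →
    memPar K ev od (Y a n b) (p + q)
  fields : ∀ a, IsFieldD K V (Y a)
  bounded : ∀ a (n : Idx K), ¬ Kbar K n → ∀ b, Y a n b = 0

/-- a bounded 𝕂̄-fold module over a bounded 𝕂̄-fold algebra -/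
structure BMod (K : Type*) [Field K] [CharZero K]
    (V : Type*) [AddCommGroup V] [Module K V] (A : BFold K V)
    (Mo : Type*) [AddCommGroup Mo] [Module K Mo] where
  evM : Submodule K Mo
  odM : Submodule K Mo
  complM : IsCompl evM odM
  YM : V →ₗ[K] EDist1 K Mo
  YM_par : ∀ a p, memPar K A.ev A.od a p → ∀ n : Idx K, EndPar K evM odM (YM a n) p
  fieldsM : ∀ a, IsFieldD K Mo (YM a)
  boundedM : ∀ a (n : Idx K), ¬ Kbar K n → ∀ c, YM a n c = 0

variable (K : Type*) [Field K] [CharZero K]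
variable (V : Type*) [AddCommGroup V] [Module K V]
variable (Mo : Type*) [AddCommGroup Mo] [Module K Mo]

/-- the operator T₁ : a ↦ a_{(−2,−1)}1 of an OPE-algebra -/
def T1 (A : OPEAlg K V) : Module.End K V where
  toFun := fun a => A.Y a ((-2 : K), (-1 : K)) A.one
  map_add' := by
    intro x y
    simp [map_add, Pi.add_apply, LinearMap.add_apply]
  map_smul' := by
    intro c x
    simp [map_smul, Pi.smul_apply, LinearMap.smul_apply]

/-- the operator T̄₁ : a ↦ a_{(−1,−2)}1 of an OPE-algebra -/
def T1b (A : OPEAlg K V) : Module.End K V where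
  toFun := fun a => A.Y a ((-1 : K), (-2 : K)) A.one
  map_add' := by
    intro x y
    simp [map_add, Pi.add_apply, LinearMap.add_apply]
  map_smul' := by
    intro c x
    simp [map_smul, Pi.smul_apply, LinearMap.smul_apply]

/-- skew-symmetry for the pair (T, T̄) -/
def SkewSym (ev od : Submodule K V) (Yf : V → EDist1 K V)
    (T Tb : Module.End K V) : Prop :=
  ∀ a b pa pb, memPar K ev od a pa → memPar K ev od b pb →
    ∀ n : Idx K, Kbar K n →
      (Function.support (fun i : ℕ × ℕ =>
        ((i.1.factorial : K)⁻¹ * (i.2.factorial : K)⁻¹ *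
            negOnePow K (n.1 + i.1 - (n.2 + i.2))) •
          ((T ^ i.1) * (Tb ^ i.2)) (Yf a (n.1 + i.1, n.2 + i.2) b))).Finite ∧
      koszul K pa pb • Yf b n a =
        ∑ᶠ i : ℕ × ℕ, ((i.1.factorial : K)⁻¹ * (i.2.factorial : K)⁻¹ *
            negOnePow K (n.1 + i.1 - (n.2 + i.2))) •
          ((T ^ i.1) * (Tb ^ i.2)) (Yf a (n.1 + i.1, n.2 + i.2) b)

/-- (T, T̄) is a translation endomorphism of the module with state-field map YM -/
def TransEnd (YM : V → EDist1 K Mo) (T Tb : Module.End K V) : Prop :=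
  (∀ a (n : Idx K), YM (T a) n = (-n.1) • YM a (n.1 - 1, n.2)) ∧
  (∀ a (n : Idx K), YM (Tb a) n = (-n.2) • YM a (n.1, n.2 - 1))

/-- the coefficient at (x-index m, w-index k) of a(𝐱+𝐰) applied to the w-distribution bw -/
def lhsXW (YM : V → EDist1 K Mo) (a : V) (bw : Dist1 K Mo) (m k : Idx K) : Mo :=
  ∑ᶠ i : ℕ × ℕ, ((i.1.factorial : K)⁻¹ * (i.2.factorial : K)⁻¹) •
    (((dz K (Module.End K Mo))^[i.1] ((dzb K (Module.End K Mo))^[i.2] (YM a))) m)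
      (bw (k.1 + i.1, k.2 + i.2))

/-- a and cM are dual in the direct channel -/
def DualDirect (Y : V → EDist1 K V) (YM : V → EDist1 K Mo) (a : V) (cM : Mo) : Prop :=
  ∃ (s : ℕ) (d : Fin s → Idx K → Idx K → (V →ₗ[K] Mo)) (hj : Fin s → Idx K),
    (∀ j, Kbar K (hj j)) ∧
    (∀ j b, InLat2 K Mo (fun kw mx => d j kw mx b)) ∧
    (∀ b (m k : Idx K),
      lhsXW K V Mo YM a (fun k' => YM b k' cM) m k =
        ∑ j, xwPow K Mo (-(hj j)) (fun kw mx => d j kw mx b) m k) ∧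
    (∀ b (m k : Idx K),
      YM (Y a m b) k cM =
        ∑ j, wxPow K Mo (-(hj j)) (fun kw mx => d j kw mx b) m k)

/-- a and b are dual in the exchange channel on the module -/
def DualExch (Y : V → EDist1 K V) (YM : V → EDist1 K Mo) (a b : V) : Prop :=
  ∃ (r : ℕ) (hab : Fin r → Idx K), (∀ i, Kbar K (hab i)) ∧
    ∀ cM : Mo, ∃ (s : ℕ) (hac : Fin s → Idx K)
      (q : Fin r → Fin s → Idx K → Idx K → Mo),
      (∀ j, Kbar K (hac j)) ∧
      (∀ i j kw mx, q i j kw mx ≠ 0 → IsNegInt K mx.1 ∧ IsNegInt K mx.2) ∧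
      (∀ i j mx, InLat1 K Mo (fun kw => q i j kw mx)) ∧
      (∀ m k : Idx K,
        lhsXW K V Mo YM a (fun k' => YM b k' cM) m k =
          ∑ j, xwPow K Mo (-(hac j))
            (fun kw mx => ∑ i, q i j kw (mx.1 - (hab i).1, mx.2 - (hab i).2)) m k) ∧
      (∀ m k : Idx K,
        YM (Y a m b) k cM =
          ∑ j, wxPow K Mo (-(hac j))
            (fun kw mx => ∑ i, q i j kw (mx.1 - (hab i).1, mx.2 - (hab i).2)) m k)

/-- the module with state-field map YM is dual -/
def IsDualMod (ev od : Submodule K V) (Y : V → EDist1 K V) (YM : V → EDist1 K Mo) : Prop :=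
  ∃ (rVV : V → V → ℕ) (hVV : ∀ a b : V, Fin (rVV a b) → Idx K)
    (rVM : V → Mo → ℕ) (hVM : ∀ (a : V) (c : Mo), Fin (rVM a c) → Idx K),
    (∀ a b i, Kbar K (hVV a b i)) ∧ (∀ a c j, Kbar K (hVM a c j)) ∧
    ∀ a b pa pb, memPar K ev od a pa → memPar K ev od b pb → ∀ c : Mo,
      ∃ p : Fin (rVV a b) → Fin (rVM a c) → Fin (rVM b c) → Dist2 K Mo,
        (∀ i j k, IsPow2 K Mo (p i j k)) ∧
        (∀ m k : Idx K,
          lhsXW K V Mo YM a (fun k' => YM b k' c) m k =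
            ∑ i, ∑ j, ∑ kk, tripleXW K Mo (-(hVV a b i)) (-(hVM b c kk))
              (-(hVM a c j)) (p i j kk) m k) ∧
        (∀ m k : Idx K,
          YM (Y a m b) k c =
            ∑ i, ∑ j, ∑ kk, tripleWX K Mo (-(hVV a b i)) (-(hVM b c kk))
              (-(hVM a c j)) (p i j kk) m k)

/-- F_Y is multiply local -/
def MultLocalAlg (A : OPEAlg K V) : Prop :=
  ∀ (r : ℕ) (f : Fin r → V) (pf : Fin r → ZMod 2),
    (∀ i, memPar K A.ev A.od (f i) (pf i)) →
      MultiplyLocal K V (fun i => A.Y (f i)) pf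

/-- F_Y is uniformly local -/
def UnifLocalAlg (A : OPEAlg K V) : Prop :=
  ∃ (rr : V → V → ℕ) (hh : ∀ a b : V, Fin (rr a b) → Idx K),
    ∀ (r : ℕ) (f : Fin r → V) (pf : Fin r → ZMod 2),
      (∀ i, memPar K A.ev A.od (f i) (pf i)) →
        ∃ c, IsMultOPE K V (fun i => A.Y (f i)) pf (fun i j => rr (f i) (f j))
            (fun i j => hh (f i) (f j)) c ∧
          ∀ α, IsPowN K V (evN K V (c α) A.one)

end OPEA
namespace OPEA

section BinomialSeries

variable {K : Type*} [Field K] [CharZero K]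

/-- the `n`-th coefficient of the power series `(1 - X)^(-h)` -/
def negBinomCoeff (h : K) (n : ℕ) : K := (-1) ^ n * gchoose K (-h) n

@[simp]
lemma negBinomCoeff_zero (h : K) : negBinomCoeff h 0 = 1 := by
  simp [negBinomCoeff, gchoose]

lemma negBinomCoeff_succ (h : K) (n : ℕ) :
    ((n : K) + 1) * negBinomCoeff h (n + 1) = (h + n) * negBinomCoeff h n := by
  have h1 : (n.factorial : K) ≠ 0 := by exact_mod_cast n.factorial_ne_zero
  have h2 : (n : K) + 1 ≠ 0 := by exact_mod_cast n.succ_ne_zero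
  simp only [negBinomCoeff, gchoose, Finset.prod_range_succ, Nat.factorial_succ, Nat.cast_mul,
    Nat.cast_add, Nat.cast_one]
  field_simp
  ring

lemma negBinomCoeff_pascal (h : K) (n : ℕ) :
    negBinomCoeff h (n + 1) = negBinomCoeff (h + 1) (n + 1) - negBinomCoeff (h + 1) n := by
  have key : ∀ n : ℕ, h * negBinomCoeff (h + 1) n = (h + n) * negBinomCoeff h n := by
    intro n
    induction n with
    | zero => simp
    | succ n ih =>
      have h2 : (n : K) + 1 ≠ 0 := by exact_mod_cast n.succ_ne_zero
      apply mul_left_cancel₀ h2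
      push_cast
      linear_combination h * negBinomCoeff_succ (h + 1) n + (h + 1 + n) * ih
        - (h + (n + 1)) * negBinomCoeff_succ h n
  induction n with
  | zero =>
    have e1 := negBinomCoeff_succ h 0
    have e2 := negBinomCoeff_succ (h + 1) 0
    simp only [Nat.cast_zero, negBinomCoeff_zero] at *
    linear_combination e1 - e2
  | succ n ih =>
    have h2 : (n : K) + 2 ≠ 0 := by exact_mod_cast (n + 1).succ_ne_zero
    have e1 := negBinomCoeff_succ h (n + 1)
    have e2 := negBinomCoeff_succ (h + 1) (n + 1)
    have k1 := key (n + 1)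
    push_cast at *
    apply mul_left_cancel₀ h2
    linear_combination e1 - e2 - k1

variable (R : Type*) [CommRing R] [Algebra K R]

/-- the power series `(1 - X)^(-h)` -/
def negBinomSeries (h : K) : PowerSeries R :=
  PowerSeries.mk fun n => algebraMap K R (negBinomCoeff h n)

lemma negBinomSeries_ne_zero [Nontrivial R] (h : K) : negBinomSeries R h ≠ 0 := by
  intro e
  simpa [negBinomSeries] using congrArg (PowerSeries.coeff 0) e

lemma derivative_negBinomSeries (h : K) :
    (1 - PowerSeries.X) * PowerSeries.derivative R (negBinomSeries R h) =
      PowerSeries.C (algebraMap K R h) * negBinomSeries R h := by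
  ext n
  have key : PowerSeries.coeff n (PowerSeries.derivative R (negBinomSeries R h)) =
      algebraMap K R ((h + n) * negBinomCoeff h n) := by
    rw [PowerSeries.coeff_derivative, negBinomSeries, PowerSeries.coeff_mk, ← negBinomCoeff_succ]
    simp [mul_comm]
  rw [sub_mul, one_mul, map_sub, key, PowerSeries.coeff_C_mul]
  cases n with
  | zero => simp [negBinomSeries]
  | succ n =>
    rw [PowerSeries.coeff_succ_X_mul, PowerSeries.coeff_derivative]
    simp only [negBinomSeries, PowerSeries.coeff_mk, map_mul, map_add]
    push_cast
    ring

variable {R} [IsDomain R]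

open Polynomial in
/-- The logarithmic derivative of a rational function along `(1 - X) d/dX` can only be a constant
if this constant is an integer. -/
lemma isInt_of_logDeriv_eq (p q : R[X]) (hp : p ≠ 0) (hq : q ≠ 0) (c : K)
    (h : p * ((1 - X) * derivative q) - q * ((1 - X) * derivative p) +
      C (algebraMap K R c) * (p * q) = 0) : IsInt K c := by
  have coeff_top : ∀ f : R[X], ((1 - X) * derivative f).coeff f.natDegree =
      -(f.natDegree * f.leadingCoeff) := by
    intro f
    have h0 : f.coeff (f.natDegree + 1) = 0 := coeff_eq_zero_of_natDegree_lt (by omega)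
    rw [sub_mul, one_mul, coeff_sub, coeff_derivative, h0]
    rcases hd : f.natDegree with _ | n
    · simp
    · rw [coeff_X_mul, coeff_derivative, leadingCoeff, hd]
      push_cast
      ring
  have natDegree_le : ∀ f : R[X], ((1 - X) * derivative f).natDegree ≤ f.natDegree := by
    intro f
    by_cases hf : derivative f = 0
    · simp [hf]
    have hd : f.natDegree ≠ 0 := by
      intro e
      rw [eq_C_of_natDegree_eq_zero e] at hf
      simp at hf
    have h1 : (1 - X : R[X]).natDegree ≤ 1 := by
      simpa using natDegree_sub_le (1 : R[X]) X
    have h2 := natDegree_derivative_lt hd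
    have h3 := natDegree_mul_le (p := (1 - X : R[X])) (q := derivative f)
    omega
  have e := congrArg (fun f => coeff f (p.natDegree + q.natDegree)) h
  simp only [coeff_add, coeff_sub, coeff_C_mul, coeff_zero] at e
  rw [coeff_mul_add_eq_of_natDegree_le le_rfl (natDegree_le q),
    coeff_mul_add_eq_of_natDegree_le le_rfl le_rfl, add_comm p.natDegree q.natDegree,
    coeff_mul_add_eq_of_natDegree_le le_rfl (natDegree_le p), coeff_top, coeff_top] at e
  have hne : p.leadingCoeff * q.leadingCoeff ≠ 0 :=
    mul_ne_zero (leadingCoeff_ne_zero.2 hp) (leadingCoeff_ne_zero.2 hq)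
  have e2 : algebraMap K R (c - (q.natDegree - p.natDegree : ℤ)) = 0 := by
    apply (mul_eq_zero.1 ?_).resolve_right hne
    simp only [coeff_natDegree] at e
    push_cast
    linear_combination e
  exact ⟨q.natDegree - p.natDegree,
    (sub_eq_zero.1 ((map_eq_zero_iff _ (algebraMap K R).injective).1 e2)).symm⟩

/-- The power series `(1 - X)^(-h)`, for exponents `h` that are pairwise distinct modulo `ℤ`,
are linearly independent over the polynomials. -/
lemma negBinomSeries_independent {ι : Type*} (h : ι → K) (S : Finset ι)
    (hS : ∀ i ∈ S, ∀ j ∈ S, IsInt K (h i - h j) → i = j) (q : ι → Polynomial R)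
    (hq : ∑ i ∈ S, (q i : PowerSeries R) * negBinomSeries R (h i) = 0) :
    ∀ i ∈ S, q i = 0 := by
  induction S using Finset.induction_on generalizing q with
  | empty => simp
  | insert a S ha ih =>
    have hS' : ∀ i ∈ S, ∀ j ∈ S, IsInt K (h i - h j) → i = j := fun i hi j hj =>
      hS i (Finset.mem_insert_of_mem hi) j (Finset.mem_insert_of_mem hj)
    rw [Finset.sum_insert ha] at hq
    have hqa : q a = 0 := by
      by_contra hne
      let D : Polynomial R → Polynomial R := fun f => (1 - Polynomial.X) * Polynomial.derivative f
      let C : K → Polynomial R := fun c => Polynomial.C (algebraMap K R c)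
      let r : ι → Polynomial R := fun i =>
        q a * (D (q i) + C (h i) * q i) - q i * (D (q a) + C (h a) * q a)
      have hD : ∀ i, (1 - PowerSeries.X) *
          PowerSeries.derivative R ((q i : PowerSeries R) * negBinomSeries R (h i)) =
          ((D (q i) + C (h i) * q i : Polynomial R) : PowerSeries R) *
            negBinomSeries R (h i) := by
        intro i
        have e := derivative_negBinomSeries R (h i)
        rw [Derivation.leibniz, PowerSeries.derivative_coe]
        simp only [smul_eq_mul, D, C, Polynomial.coe_add, Polynomial.coe_mul, Polynomial.coe_sub,
          Polynomial.coe_one, Polynomial.coe_X, Polynomial.coe_C]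
        linear_combination (q i : PowerSeries R) * e
      have hr : ∑ i ∈ S, (r i : PowerSeries R) * negBinomSeries R (h i) = 0 := by
        have e := congrArg
          (fun f => (1 - PowerSeries.X) * PowerSeries.derivative R f) hq
        simp only [map_add, map_sum, map_zero, mul_zero, mul_add, Finset.mul_sum, hD] at e
        have e1 : ∑ i ∈ S, (r i : PowerSeries R) * negBinomSeries R (h i) =
            (q a : PowerSeries R) * ∑ i ∈ S, ((D (q i) + C (h i) * q i : Polynomial R) :
              PowerSeries R) * negBinomSeries R (h i) -
            ((D (q a) + C (h a) * q a : Polynomial R) : PowerSeries R) *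
              ∑ i ∈ S, (q i : PowerSeries R) * negBinomSeries R (h i) := by
          rw [Finset.mul_sum, Finset.mul_sum, ← Finset.sum_sub_distrib]
          refine Finset.sum_congr rfl fun i _ => ?_
          simp only [r, Polynomial.coe_sub, Polynomial.coe_mul]
          ring
        rw [e1]
        linear_combination (q a : PowerSeries R) * e -
          ((D (q a) + C (h a) * q a : Polynomial R) : PowerSeries R) * hq
      have hq0 : ∀ i ∈ S, q i = 0 := by
        intro i hi
        by_contra hi0
        have hri := ih hS' r hr i hi
        have hint : IsInt K (h i - h a) := by
          refine isInt_of_logDeriv_eq (q a) (q i) hne hi0 _ ?_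
          simp only [r, D, C] at hri
          rw [map_sub, Polynomial.C_sub]
          linear_combination hri
        exact ha (hS i (Finset.mem_insert_of_mem hi) a (Finset.mem_insert_self _ _) hint ▸ hi)
      rw [Finset.sum_eq_zero fun i hi => by rw [hq0 i hi]; simp, add_zero] at hq
      rcases mul_eq_zero.1 hq with h1 | h1
      · exact hne (by exact_mod_cast h1)
      · exact negBinomSeries_ne_zero R _ h1
    rw [hqa] at hq
    simp only [Polynomial.coe_zero, zero_mul, zero_add] at hq
    intro i hi
    rcases Finset.mem_insert.1 hi with rfl | hi
    · exact hqa
    · exact ih hS' q hq i hi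

end BinomialSeries

section Expansions

variable {K : Type*} [Field K] [CharZero K]

/-- `negBinomCoeff` with the index taken in `K` (zero unless it is a natural number) -/
def negBinomCoeffAt (h x : K) : K :=
  if e : ∃ n : ℕ, (n : K) = x then negBinomCoeff h e.choose else 0

lemma negBinomCoeffAt_natCast (h : K) (n : ℕ) :
    negBinomCoeffAt h (n : K) = negBinomCoeff h n := by
  have e : ∃ k : ℕ, (k : K) = n := ⟨n, rfl⟩
  rw [negBinomCoeffAt, dif_pos e, Nat.cast_injective e.choose_spec]

lemma negBinomCoeffAt_of_not {h x : K} (e : ¬ ∃ n : ℕ, (n : K) = x) :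
    negBinomCoeffAt h x = 0 := by
  rw [negBinomCoeffAt, dif_neg e]

lemma exists_natCast_of_negBinomCoeffAt_ne_zero {h x : K} (e : negBinomCoeffAt h x ≠ 0) :
    ∃ n : ℕ, (n : K) = x := by
  by_contra hx
  exact e (negBinomCoeffAt_of_not hx)

lemma negBinomCoeffAt_pascal (h x : K) :
    negBinomCoeffAt h x = negBinomCoeffAt (h + 1) x - negBinomCoeffAt (h + 1) (x - 1) := by
  by_cases e : ∃ n : ℕ, (n : K) = x
  · obtain ⟨n, rfl⟩ := e
    cases n with
    | zero =>
      have h0 : ¬ ∃ n : ℕ, (n : K) = ((0 : ℕ) : K) - 1 := by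
        rintro ⟨n, hn⟩
        have : ((n + 1 : ℕ) : K) = 0 := by push_cast at *; linear_combination hn
        exact n.succ_ne_zero (by exact_mod_cast this)
      simp only [negBinomCoeffAt_of_not h0, negBinomCoeffAt_natCast, negBinomCoeff_zero, sub_zero]
    | succ n =>
      have h1 : ((n + 1 : ℕ) : K) - 1 = n := by push_cast; ring
      rw [h1]
      simp only [negBinomCoeffAt_natCast]
      exact negBinomCoeff_pascal h n
  · have e' : ¬ ∃ n : ℕ, (n : K) = x - 1 := by
      rintro ⟨n, hn⟩
      exact e ⟨n + 1, by push_cast; linear_combination hn⟩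
    simp only [negBinomCoeffAt_of_not e, negBinomCoeffAt_of_not e', sub_zero]

lemma negOnePow_intCast (k : ℤ) : negOnePow K (k : K) = (-1) ^ k := by
  have e : ∃ l : ℤ, (l : K) = k := ⟨k, rfl⟩
  rw [negOnePow, dif_pos e, Int.cast_injective e.choose_spec]

lemma negOnePow_add_one {x : K} (hx : IsInt K x) : negOnePow K (x + 1) = -negOnePow K x := by
  obtain ⟨k, rfl⟩ := hx
  have : (k : K) + 1 = ((k + 1 : ℤ) : K) := by push_cast; rfl
  rw [this, negOnePow_intCast, negOnePow_intCast, zpow_add₀ (by simp)]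
  simp

lemma negOnePow_sub_one {x : K} (hx : IsInt K x) : negOnePow K (x - 1) = -negOnePow K x := by
  obtain ⟨k, rfl⟩ := hx
  have := negOnePow_add_one (x := (k : K) - 1) ⟨k - 1, by push_cast; rfl⟩
  rw [sub_add_cancel] at this
  rw [this, neg_neg]

lemma negOnePow_ne_zero (x : K) : negOnePow K x ≠ 0 := by
  unfold negOnePow
  split_ifs
  · exact zpow_ne_zero _ (by simp)
  · exact one_ne_zero

/-- the expansion for `w > z` of `(𝐳-𝐰)^(-h)` times the monomial with index `α` in `𝐳`, restricted to
a fixed total degree and as a function of the index of `𝐳` -/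
def expW (h α m : Idx K) : K :=
  negOnePow K (-h.1 - -h.2) *
    (negBinomCoeffAt h.1 (α.1 - m.1) * negBinomCoeffAt h.2 (α.2 - m.2))

/-- the expansion for `z > w` of `(𝐳-𝐰)^(-h)` times the monomial with index `α` in `𝐳`, restricted to
a fixed total degree and as a function of the index of `𝐳` -/
def expZ (h α m : Idx K) : K :=
  negBinomCoeffAt h.1 (m.1 - h.1 - α.1) * negBinomCoeffAt h.2 (m.2 - h.2 - α.2)

/-- both expansions of `(𝐳-𝐰)^(-h)` times a monomial -/
def expPair (p : Idx K × Idx K) : (Idx K → K) × (Idx K → K) :=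
  (expW p.1 p.2, expZ p.1 p.2)

/-- the span of the expansions of `(𝐳-𝐰)^(-h)` times monomials -/
def expSpan (h : Idx K) : Submodule K ((Idx K → K) × (Idx K → K)) :=
  Submodule.span K (Set.range fun α => expPair (h, α))

lemma expPair_mem_expSpan (h α : Idx K) : expPair (h, α) ∈ expSpan h :=
  Submodule.subset_span ⟨α, rfl⟩

lemma expSpan_le_fst {h : Idx K} (hh : Kbar K h) : expSpan h ≤ expSpan (h.1 + 1, h.2) := by
  refine Submodule.span_le.2 ?_
  rintro _ ⟨α, rfl⟩
  have e : expPair (h, α) =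
      expPair ((h.1 + 1, h.2), (α.1 - 1, α.2)) - expPair ((h.1 + 1, h.2), α) := by
    obtain ⟨k, hk⟩ := hh
    have hs : negOnePow K (-(h.1 + 1) - -h.2) = -negOnePow K (-h.1 - -h.2) := by
      rw [← negOnePow_sub_one ⟨-k, by push_cast; linear_combination -hk⟩]
      congr 1; ring
    refine Prod.ext (funext fun m => ?_) (funext fun m => ?_)
    · simp only [expPair, expW, Prod.fst_sub, Pi.sub_apply, hs]
      rw [negBinomCoeffAt_pascal h.1, show α.1 - 1 - m.1 = α.1 - m.1 - 1 by ring]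
      ring
    · simp only [expPair, expZ, Prod.snd_sub, Pi.sub_apply]
      rw [negBinomCoeffAt_pascal h.1,
        show m.1 - (h.1 + 1) - (α.1 - 1) = m.1 - h.1 - α.1 by ring,
        show m.1 - (h.1 + 1) - α.1 = m.1 - h.1 - α.1 - 1 by ring]
      ring
  change expPair (h, α) ∈ _
  rw [e]
  exact Submodule.sub_mem _ (expPair_mem_expSpan _ _) (expPair_mem_expSpan _ _)

lemma expSpan_le_snd {h : Idx K} (hh : Kbar K h) : expSpan h ≤ expSpan (h.1, h.2 + 1) := by
  refine Submodule.span_le.2 ?_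
  rintro _ ⟨α, rfl⟩
  have e : expPair (h, α) =
      expPair ((h.1, h.2 + 1), (α.1, α.2 - 1)) - expPair ((h.1, h.2 + 1), α) := by
    obtain ⟨k, hk⟩ := hh
    have hs : negOnePow K (-h.1 - -(h.2 + 1)) = -negOnePow K (-h.1 - -h.2) := by
      rw [← negOnePow_add_one ⟨-k, by push_cast; linear_combination -hk⟩]
      congr 1; ring
    refine Prod.ext (funext fun m => ?_) (funext fun m => ?_)
    · simp only [expPair, expW, Prod.fst_sub, Pi.sub_apply, hs]
      rw [negBinomCoeffAt_pascal h.2, show α.2 - 1 - m.2 = α.2 - m.2 - 1 by ring]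
      ring
    · simp only [expPair, expZ, Prod.snd_sub, Pi.sub_apply]
      rw [negBinomCoeffAt_pascal h.2,
        show m.2 - (h.2 + 1) - (α.2 - 1) = m.2 - h.2 - α.2 by ring,
        show m.2 - (h.2 + 1) - α.2 = m.2 - h.2 - α.2 - 1 by ring]
      ring
  change expPair (h, α) ∈ _
  rw [e]
  exact Submodule.sub_mem _ (expPair_mem_expSpan _ _) (expPair_mem_expSpan _ _)

lemma expSpan_le_add {h : Idx K} (hh : Kbar K h) (a b : ℕ) :
    expSpan h ≤ expSpan (h.1 + a, h.2 + b) := by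
  obtain ⟨k, hk⟩ := hh
  have h1 : expSpan h ≤ expSpan (h.1 + a, h.2) := by
    induction a with
    | zero => simp
    | succ a ih =>
      refine ih.trans ((expSpan_le_fst ⟨k + a, ?_⟩).trans (le_of_eq ?_))
      · push_cast; linear_combination hk
      · push_cast; simp only [add_assoc]
  refine h1.trans ?_
  induction b with
  | zero => simp
  | succ b ih =>
    refine ih.trans ((expSpan_le_snd ⟨k + a - b, ?_⟩).trans (le_of_eq ?_))
    · push_cast; linear_combination hk
    · push_cast; simp only [add_assoc]

lemma exists_int_bound (A : Finset K) : ∃ N : ℕ, ∀ k : ℤ, (k : K) ∈ A → |k| ≤ N := by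
  let B : Finset ℤ := A.preimage (fun k : ℤ => (k : K)) Int.cast_injective.injOn
  refine ⟨B.sup Int.natAbs, fun k hk => ?_⟩
  have : k.natAbs ≤ B.sup Int.natAbs := Finset.le_sup (f := Int.natAbs) (by simpa [B] using hk)
  rw [Int.abs_eq_natAbs]
  exact_mod_cast this

/-- Finitely many exponents in `𝕂̄` can be raised by natural numbers so that any two of them that
are congruent modulo `ℤ` become equal. -/
lemma exists_common_exponents {ι : Type*} [Fintype ι] (h : ι → Idx K) (hh : ∀ i, Kbar K (h i)) :
    ∃ H : ι → Idx K, (∀ i, ∃ a b : ℕ, H i = ((h i).1 + a, (h i).2 + b)) ∧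
      ∀ i j, IsInt K ((H i).1 - (H j).1) → H i = H j := by
  let s : Setoid K :=
    { r := fun x y => IsInt K (x - y)
      iseqv :=
        { refl := fun x => ⟨0, by simp⟩
          symm := fun ⟨k, hk⟩ => ⟨-k, by push_cast; linear_combination -hk⟩
          trans := fun ⟨k, hk⟩ ⟨l, hl⟩ => ⟨k + l, by push_cast; linear_combination hk + hl⟩ } }
  let ρ : K → K := fun x => (Quotient.mk s x).out
  have hρ : ∀ x, IsInt K (x - ρ x) := fun x => Setoid.symm (Quotient.mk_out (s := s) x)
  have hρ_eq : ∀ x y, IsInt K (x - y) → ρ x = ρ y := fun x y e =>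
    congrArg Quotient.out (Quotient.sound (s := s) e)
  choose d hd using fun i => hρ (h i).1
  choose k hk using hh
  obtain ⟨N, hN⟩ := exists_int_bound
    (Finset.univ.image (fun i => (d i : K)) ∪ Finset.univ.image (fun i => ((d i - k i : ℤ) : K)))
  refine ⟨fun i => (ρ (h i).1 + N, ρ (h i).1 + N), fun i => ?_, fun i j e => ?_⟩
  · have h1 := abs_le.1 (hN (d i) (by simp))
    have h2 := abs_le.1 (hN (d i - k i)
      (Finset.mem_union_right _ (Finset.mem_image_of_mem _ (Finset.mem_univ i))))
    obtain ⟨a, ha⟩ := Int.eq_ofNat_of_zero_le (show 0 ≤ N - d i by omega)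
    obtain ⟨b, hb⟩ := Int.eq_ofNat_of_zero_le (show 0 ≤ N - (d i - k i) by omega)
    have ha' : (N : K) - d i = a := by exact_mod_cast congrArg (Int.cast : ℤ → K) ha
    have hb' : (N : K) - (d i - k i) = b := by exact_mod_cast congrArg (Int.cast : ℤ → K) hb
    refine ⟨a, b, Prod.ext ?_ ?_⟩
    · simp only
      linear_combination hd i + ha'
    · simp only
      linear_combination hd i + hb' - hk i
  · have e1 : ρ (h i).1 = ρ (h j).1 := by
      obtain ⟨l, hl⟩ := e
      refine hρ_eq _ _ ⟨l + d i - d j, ?_⟩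
      push_cast
      linear_combination hl + hd i - hd j
    simp only [e1]

open PowerSeries in
lemma coeff_coeff_monomial_mul_negBinomSeries (h : Idx K) (a b : ℕ × ℕ) (y : K) :
    coeff b.2 (coeff b.1
      (((Polynomial.C (C y * X ^ a.2 * negBinomSeries K h.2) * Polynomial.X ^ a.1 :
        Polynomial K⟦X⟧) : K⟦X⟧⟦X⟧) * negBinomSeries K⟦X⟧ h.1)) =
      y * (negBinomCoeffAt h.1 ((b.1 : K) - a.1) * negBinomCoeffAt h.2 ((b.2 : K) - a.2)) := by
  have not_nat : ∀ {s t : ℕ}, ¬ s ≤ t → ¬ ∃ n : ℕ, (n : K) = (t : K) - s := by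
    rintro s t hst ⟨n, hn⟩
    have : n + s = t := by exact_mod_cast (show (n : K) + s = t by linear_combination hn)
    omega
  rw [Polynomial.coe_mul, Polynomial.coe_C, Polynomial.coe_pow, Polynomial.coe_X, mul_comm (C _),
    mul_assoc, coeff_X_pow_mul']
  split_ifs with h1
  · rw [coeff_C_mul, negBinomSeries, negBinomSeries, coeff_mk,
      mul_comm (C y), mul_assoc, mul_assoc, coeff_X_pow_mul']
    split_ifs with h2
    · rw [coeff_C_mul, ← Nat.cast_sub h1, ← Nat.cast_sub h2, negBinomCoeffAt_natCast,
        negBinomCoeffAt_natCast, PowerSeries.algebraMap_apply, mul_comm _ (C _), coeff_C_mul,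
        coeff_mk]
      simp
    · simp [negBinomCoeffAt_of_not (not_nat h2)]
  · simp [negBinomCoeffAt_of_not (not_nat h1)]

open PowerSeries in
/-- The expansions for `w > z` of `(𝐳-𝐰)^(-h)` times monomials are linearly independent if `h` runs
through exponents that are pairwise distinct modulo `ℤ`. -/
lemma expW_independent (x : Idx K × Idx K →₀ K)
    (hx : ∀ p ∈ x.support, ∀ p' ∈ x.support, IsInt K (p.1.1 - p'.1.1) → p.1 = p'.1)
    (h0 : ∀ m, ∑ p ∈ x.support, x p * expW p.1 p.2 m = 0) : x = 0 := by
  by_contra hne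
  obtain ⟨p₀, hp₀⟩ := Finsupp.support_nonempty_iff.2 hne
  obtain ⟨N, hN⟩ := exists_int_bound
    (x.support.image (fun p => p.2.1 - p₀.2.1) ∪ x.support.image (fun p => p.2.2 - p₀.2.2))
  let T := x.support.filter fun p =>
    ∃ a : ℕ × ℕ, p.2 = (p₀.2.1 + N - a.1, p₀.2.2 + N - a.2)
  have exists_shift : ∀ p : Idx K × Idx K, ∃ a : ℕ × ℕ, p ∈ T →
      p.2 = (p₀.2.1 + N - a.1, p₀.2.2 + N - a.2) := fun p => by
    by_cases hp : p ∈ T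
    · exact (Finset.mem_filter.1 hp).2.imp fun _ ha _ => ha
    · exact ⟨0, fun hp' => absurd hp' hp⟩
  choose a ha using exists_shift
  have hp₀T : p₀ ∈ T := Finset.mem_filter.2 ⟨hp₀, (N, N), by simp⟩
  have mem_T : ∀ p ∈ x.support, ∀ b : ℕ × ℕ,
      expW p.1 p.2 (p₀.2.1 + N - b.1, p₀.2.2 + N - b.2) ≠ 0 → p ∈ T := by
    intro p hp b hpb
    obtain ⟨-, hpb⟩ := mul_ne_zero_iff.1 hpb
    obtain ⟨h1, h2⟩ := mul_ne_zero_iff.1 hpb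
    obtain ⟨n1, hn1⟩ := exists_natCast_of_negBinomCoeffAt_ne_zero h1
    obtain ⟨n2, hn2⟩ := exists_natCast_of_negBinomCoeffAt_ne_zero h2
    have e1 : ((n1 + N - b.1 : ℤ) : K) = p.2.1 - p₀.2.1 := by
      push_cast; linear_combination hn1
    have e2 : ((n2 + N - b.2 : ℤ) : K) = p.2.2 - p₀.2.2 := by
      push_cast; linear_combination hn2
    have l1 := abs_le.1 (hN (n1 + N - b.1)
      (Finset.mem_union_left _ (Finset.mem_image.2 ⟨p, hp, e1.symm⟩)))
    have l2 := abs_le.1 (hN (n2 + N - b.2)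
      (Finset.mem_union_right _ (Finset.mem_image.2 ⟨p, hp, e2.symm⟩)))
    have c1 : n1 ≤ b.1 := by omega
    have c2 : n2 ≤ b.2 := by omega
    refine Finset.mem_filter.2 ⟨hp, (b.1 - n1, b.2 - n2), Prod.ext ?_ ?_⟩
    · simp only [Nat.cast_sub c1]
      linear_combination -hn1
    · simp only [Nat.cast_sub c2]
      linear_combination -hn2
  let y : Idx K × Idx K → K := fun p => x p * negOnePow K (-p.1.1 - -p.1.2)
  let q : Idx K → Polynomial K⟦X⟧ := fun h => ∑ p ∈ T with p.1 = h,
    Polynomial.C (C (y p) * X ^ (a p).2 * negBinomSeries K p.1.2) * Polynomial.X ^ (a p).1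
  have hq : ∑ h ∈ T.image Prod.fst, (q h : K⟦X⟧⟦X⟧) * negBinomSeries K⟦X⟧ h.1 = 0 := by
    have e : ∑ h ∈ T.image Prod.fst, (q h : K⟦X⟧⟦X⟧) * negBinomSeries K⟦X⟧ h.1 =
        ∑ p ∈ T, ((Polynomial.C (C (y p) * X ^ (a p).2 * negBinomSeries K p.1.2) *
          Polynomial.X ^ (a p).1 : Polynomial K⟦X⟧) : K⟦X⟧⟦X⟧) *
            negBinomSeries K⟦X⟧ p.1.1 := by
      rw [← Finset.sum_fiberwise_of_maps_to (t := T.image Prod.fst) (g := Prod.fst)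
        fun p hp => Finset.mem_image_of_mem _ hp]
      refine Finset.sum_congr rfl fun h _ => ?_
      rw [← Polynomial.coeToPowerSeries.ringHom_apply, map_sum, Finset.sum_mul]
      refine Finset.sum_congr rfl fun p hp => ?_
      rw [(Finset.mem_filter.1 hp).2, Polynomial.coeToPowerSeries.ringHom_apply]
    rw [e]
    ext b1 b2
    simp only [map_sum, map_zero]
    rw [← h0 (p₀.2.1 + N - b1, p₀.2.2 + N - b2),
      ← Finset.sum_subset (Finset.filter_subset _ _ : T ⊆ _)]
    · refine Finset.sum_congr rfl fun p hp => ?_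
      rw [coeff_coeff_monomial_mul_negBinomSeries p.1 (a p) (b1, b2), expW, ha p hp]
      simp only [y]
      rw [mul_assoc]
      congr! 4 <;> ring
    · intro p hp hpT
      by_contra hc
      exact hpT (mem_T p hp (b1, b2) (right_ne_zero_of_mul hc))
  have hq0 : q p₀.1 = 0 := by
    refine negBinomSeries_independent Prod.fst (T.image Prod.fst) ?_ q hq _
      (Finset.mem_image_of_mem _ hp₀T)
    intro h hh h' hh' e
    obtain ⟨p, hp, rfl⟩ := Finset.mem_image.1 hh
    obtain ⟨p', hp', rfl⟩ := Finset.mem_image.1 hh'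
    exact hx p (Finset.mem_filter.1 hp).1 p' (Finset.mem_filter.1 hp').1 e
  have hc : (∑ p ∈ T with p.1 = p₀.1, if (a p₀).1 = (a p).1 then C (y p) * X ^ (a p).2 else 0) *
      negBinomSeries K p₀.1.2 = 0 := by
    refine Eq.trans ?_ (congrArg (fun f => Polynomial.coeff f (a p₀).1) hq0)
    simp only [q]
    rw [Polynomial.finsetSum_coeff, Finset.sum_mul]
    refine Finset.sum_congr rfl fun p hp => ?_
    rw [Polynomial.coeff_C_mul_X_pow, (Finset.mem_filter.1 hp).2, ite_mul, zero_mul]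
  have hc' := congrArg (coeff (a p₀).2)
    ((mul_eq_zero.1 hc).resolve_right (negBinomSeries_ne_zero K _))
  rw [map_sum, Finset.sum_eq_single_of_mem p₀ (by simp [hp₀T])] at hc'
  · rw [if_pos rfl, coeff_C_mul, coeff_X_pow_self, mul_one, map_zero] at hc'
    exact mul_ne_zero (Finsupp.mem_support_iff.1 hp₀) (negOnePow_ne_zero _) hc'
  · intro p hp hpp
    obtain ⟨hpT, hp1⟩ := Finset.mem_filter.1 hp
    split_ifs with h1
    · rw [coeff_C_mul, coeff_X_pow, if_neg, mul_zero]
      intro h2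
      exact hpp (Prod.ext hp1 ((ha p hpT).trans (by rw [← h1, ← h2]; exact (ha p₀ hp₀T).symm)))
    · exact map_zero _

/-- A relation between the expansions for `w > z` also holds for the expansions for `z > w`. -/
lemma eq_zero_of_fst_eq_zero {ι : Type*} [Fintype ι] (h : ι → Idx K) (hh : ∀ i, Kbar K (h i))
    (v : ι → (Idx K → K) × (Idx K → K)) (hv : ∀ i, v i ∈ expSpan (h i))
    (h0 : (∑ i, v i).1 = 0) : ∑ i, v i = 0 := by
  obtain ⟨H, hH, hH_eq⟩ := exists_common_exponents h hh
  let s : Set (Idx K × Idx K) := {p | p.1 ∈ Set.range H}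
  have hspan : ∑ i, v i ∈ Submodule.span K (expPair '' s) := by
    refine Submodule.sum_mem _ fun i _ => ?_
    obtain ⟨a, b, hab⟩ := hH i
    have h1 : v i ∈ expSpan (H i) := hab ▸ expSpan_le_add (hh i) a b (hv i)
    refine Submodule.span_mono ?_ h1
    rintro _ ⟨α, rfl⟩
    exact ⟨(H i, α), ⟨i, rfl⟩, rfl⟩
  obtain ⟨x, hxs, hx⟩ := (Finsupp.mem_span_image_iff_linearCombination K).1 hspan
  rw [← hx] at h0 ⊢
  suffices x = 0 by rw [this, map_zero]
  refine expW_independent x ?_ fun m => ?_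
  · intro p hp p' hp' e
    obtain ⟨i, hi⟩ := (Finsupp.mem_supported _ _).1 hxs hp
    obtain ⟨j, hj⟩ := (Finsupp.mem_supported _ _).1 hxs hp'
    rw [← hi, ← hj] at e ⊢
    exact hH_eq i j e
  · have e := congrFun h0 m
    rw [Finsupp.linearCombination_apply, Finsupp.sum, Prod.fst_sum, Finset.sum_apply] at e
    exact e

end Expansions

section Transfer

variable {K : Type*} [Field K] [CharZero K] {M : Type*} [AddCommGroup M] [Module K M]

lemma finite_setOf_isNegInt (N μ ν : K) :
    {x : K | IsNegInt K (x - μ) ∧ IsNegInt K (N - x - ν)}.Finite := by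
  by_cases e : ∃ j : ℤ, (j : K) = N - μ - ν
  · obtain ⟨j, hj⟩ := e
    refine ((Set.finite_Ioo j 0).image fun k : ℤ => μ + k).subset ?_
    rintro x ⟨⟨k, hk, hk'⟩, ⟨l, hl, hl'⟩⟩
    have : j = k + l := by
      exact_mod_cast (show (j : K) = k + l by linear_combination hj - hk' - hl')
    exact ⟨k, ⟨by omega, hk⟩, by simp only; linear_combination hk'⟩
  · convert Set.finite_empty
    refine Set.eq_empty_of_forall_notMem ?_
    rintro x ⟨⟨k, -, hk'⟩, ⟨l, -, hl'⟩⟩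
    exact e ⟨k + l, by push_cast; linear_combination hk' + hl'⟩

/-- A homogeneous component of an element of `M⌊𝐳,𝐰⌋` has finitely many nonzero coefficients. -/
lemma InLat2.finite_support_antidiagonal {c : Dist2 K M} (hc : InLat2 K M c) (N : Idx K) :
    (Function.support fun α : Idx K => c α (N - α)).Finite := by
  obtain ⟨S, hS⟩ := hc
  refine (S.finite_toSet.biUnion fun μ _ => (finite_setOf_isNegInt N.1 μ.1.1 μ.2.1).prod
    (finite_setOf_isNegInt N.2 μ.1.2 μ.2.2)).subset fun α hα => ?_
  obtain ⟨μ, hμ, ⟨h1, h2⟩, h3, h4⟩ := hS _ _ hα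
  exact Set.mem_biUnion hμ ⟨⟨h1, h3⟩, h2, h4⟩

lemma finsum_comp_eq_sum {ι κ : Type*} {e : ι → κ} (he : Function.Injective e) (G : κ → M)
    (A : Finset κ) (hA : Function.support G ⊆ A) (hG : ∀ α, α ∉ Set.range e → G α = 0) :
    ∑ᶠ i, G (e i) = ∑ α ∈ A, G α := by
  rw [← finsum_mem_range he, ← finsum_eq_sum_of_support_subset G hA,
    ← finsum_mem_inter_support, ← finsum_mem_univ G, ← finsum_mem_inter_support G Set.univ]
  congr! 4 with α
  refine Set.ext fun α => ⟨fun h => ⟨trivial, h.2⟩, fun h => ⟨?_, h.2⟩⟩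
  by_contra hα
  exact h.2 (hG α hα)

lemma zwPowW_eq_sum (h N : Idx K) (c : Dist2 K M) (A : Finset (Idx K))
    (hA : Function.support (fun α : Idx K => c α (N - h - α)) ⊆ A) (m : Idx K) :
    zwPowW K M (-h) c m (N - m) = ∑ α ∈ A, expW h α m • c α (N - h - α) := by
  let e : ℕ × ℕ → Idx K := fun i => (m.1 + i.1, m.2 + i.2)
  have he : Function.Injective e := by
    intro i j hij
    simp only [e, Prod.mk.injEq, add_right_inj, Nat.cast_inj] at hij
    exact Prod.ext hij.1 hij.2
  rw [← finsum_comp_eq_sum he (fun α => expW h α m • c α (N - h - α)) A]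
  · refine finsum_congr fun i => ?_
    congr 1
    · simp only [expW, e, add_sub_cancel_left, negBinomCoeffAt_natCast, negBinomCoeff, pow_add,
        Prod.fst_neg, Prod.snd_neg]
      ring
    · refine congrArg _ (Prod.ext ?_ ?_) <;> simp [e] <;> ring
  · exact fun α hα => hA (right_ne_zero_of_smul hα)
  · intro α hα
    suffices expW h α m = 0 by simp only [this, zero_smul]
    by_contra hne
    obtain ⟨-, hne⟩ := mul_ne_zero_iff.1 hne
    obtain ⟨h1, h2⟩ := mul_ne_zero_iff.1 hne
    obtain ⟨n1, hn1⟩ := exists_natCast_of_negBinomCoeffAt_ne_zero h1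
    obtain ⟨n2, hn2⟩ := exists_natCast_of_negBinomCoeffAt_ne_zero h2
    exact hα ⟨(n1, n2), Prod.ext (by simp only [e]; rw [hn1]; ring)
      (by simp only [e]; rw [hn2]; ring)⟩

lemma zwPow_eq_sum (h N : Idx K) (c : Dist2 K M) (A : Finset (Idx K))
    (hA : Function.support (fun α : Idx K => c α (N - h - α)) ⊆ A) (m : Idx K) :
    zwPow K M (-h) c m (N - m) = ∑ α ∈ A, expZ h α m • c α (N - h - α) := by
  let e : ℕ × ℕ → Idx K := fun i => (m.1 - h.1 - i.1, m.2 - h.2 - i.2)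
  have he : Function.Injective e := by
    intro i j hij
    simp only [e, Prod.mk.injEq, sub_right_inj, Nat.cast_inj] at hij
    exact Prod.ext hij.1 hij.2
  rw [← finsum_comp_eq_sum he (fun α => expZ h α m • c α (N - h - α)) A]
  · refine finsum_congr fun i => ?_
    congr 1
    · simp only [expZ, e, sub_sub_cancel, negBinomCoeffAt_natCast, negBinomCoeff, pow_add,
        Prod.fst_neg, Prod.snd_neg]
      ring
    · refine congrArg₂ _ (Prod.ext ?_ ?_) (Prod.ext ?_ ?_) <;> simp [e] <;> ring
  · exact fun α hα => hA (right_ne_zero_of_smul hα)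
  · intro α hα
    suffices expZ h α m = 0 by simp only [this, zero_smul]
    by_contra hne
    obtain ⟨h1, h2⟩ := mul_ne_zero_iff.1 hne
    obtain ⟨n1, hn1⟩ := exists_natCast_of_negBinomCoeffAt_ne_zero h1
    obtain ⟨n2, hn2⟩ := exists_natCast_of_negBinomCoeffAt_ne_zero h2
    exact hα ⟨(n1, n2), Prod.ext (by simp only [e]; rw [hn1]; ring)
      (by simp only [e]; rw [hn2]; ring)⟩

/-- If a sum of distributions `(𝐳-𝐰)^(-h) c(𝐳,𝐰)`, with `c` in `M⌊𝐳,𝐰⌋`, vanishes when expanded for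
`w > z`, then it vanishes when expanded for `z > w`. -/
lemma sum_zwPow_eq_zero {ι : Type*} [Fintype ι] (h : ι → Idx K) (hh : ∀ i, Kbar K (h i))
    (c : ι → Dist2 K M) (hc : ∀ i, InLat2 K M (c i))
    (h0 : ∀ m k, ∑ i, zwPowW K M (-(h i)) (c i) m k = 0) (m k : Idx K) :
    ∑ i, zwPow K M (-(h i)) (c i) m k = 0 := by
  rw [← Module.forall_dual_apply_eq_zero_iff K]
  intro φ
  let N := k + m
  choose A hA using fun i => ((hc i).finite_support_antidiagonal (N - h i)).exists_finset_coe
  let v : ι → (Idx K → K) × (Idx K → K) := fun i =>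
    ∑ α ∈ A i, φ (c i α (N - h i - α)) • expPair (h i, α)
  have hv : ∑ i, v i = 0 := by
    refine eq_zero_of_fst_eq_zero h hh v
      (fun i => Submodule.sum_mem _ fun α _ => Submodule.smul_mem _ _ (expPair_mem_expSpan _ _))
      (funext fun m' => ?_)
    have e := congrArg φ (h0 m' (N - m'))
    simp only [zwPowW_eq_sum _ N _ (A _) (hA _).ge, map_sum, map_smul, map_zero] at e
    simpa [v, expPair, Prod.fst_sum, Finset.sum_apply, mul_comm] using e
  have e := congrFun (congrArg Prod.snd hv) m
  have hk : k = N - m := by simp [N]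
  rw [hk]
  simp only [zwPow_eq_sum _ N _ (A _) (hA _).ge, map_sum, map_smul]
  simpa [v, expPair, Prod.snd_sum, Finset.sum_apply, mul_comm] using e

end Transfer

lemma CreativeD.eq_zero {K : Type*} [Field K] [CharZero K]
    {E : Type*} [AddCommGroup E] [Module K E] {T Tb : Module.End K E} {d : Dist1 K E}
    (hd : CreativeD K E T Tb d) (h0 : d ((-1 : K), (-1 : K)) = 0) : d = 0 := by
  funext n
  by_cases hn : ∃ i : ℕ × ℕ, n = (-(i.1 : K) - 1, -(i.2 : K) - 1)
  · obtain ⟨i, rfl⟩ := hn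
    rw [hd.1, h0, map_zero, smul_zero, Pi.zero_apply]
  · exact hd.2 n hn

/-- If `a(𝐳)` and `b(𝐳)` are local and `a(𝐳)` annihilates a vector `v`, then `a(𝐳)b(𝐰)v = 0`. -/
lemma IsLocal.apply_eq_zero {K : Type*} [Field K] [CharZero K]
    {E : Type*} [AddCommGroup E] [Module K E] {pa pb : ZMod 2} {a b : EDist1 K E}
    (hab : IsLocal K E pa pb a b) {v : E} (hv : ∀ m, a m v = 0) (m k : Idx K) :
    a m (b k v) = 0 := by
  obtain ⟨r, c, h, hh, hc, h1, h2⟩ := hab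
  rw [h1]
  refine sum_zwPow_eq_zero h hh _ (fun i => hc i v) (fun m' k' => ?_) m k
  rw [← h2, hv, map_zero, smul_zero]

/-- Goddard's uniqueness theorem: for a creative, complete, local
graded subspace F of homogeneous distributions, s₁ : F → E is a linear isomorphism. -/
theorem stmt_18 (K : Type*) [Field K] [CharZero K]
    (E : Type*) [AddCommGroup E] [Module K E]
    (evE odE : Submodule K E) (hgr : IsCompl evE odE)
    (one : E) (hone : one ∈ evE)
    (T Tb : Module.End K E) (hT : EndPar K evE odE T 0) (hTb : EndPar K evE odE Tb 0)
    (F : Submodule K (EDist1 K E)) (pF : EDist1 K E → ZMod 2)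
    (hhom : ∀ d ∈ F, EDistPar K evE odE d (pF d))
    (hcre : ∀ d ∈ F, CreativeD K E T Tb (ev1 K E d one))
    (hcomp : ∀ v : E, ∃ d ∈ F, d ((-1 : K), (-1 : K)) one = v)
    (hloc : ∀ d ∈ F, ∀ e ∈ F, IsLocal K E (pF d) (pF e) d e) :
    Function.Bijective (fun d : F => (d : EDist1 K E) ((-1 : K), (-1 : K)) one) := by
  constructor
  · intro a b hab
    have hd : ∀ m, (a - b : F).1 m one = 0 := congrFun
      ((hcre _ (a - b).2).eq_zero (sub_eq_zero.2 hab))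
    refine sub_eq_zero.1 (Subtype.ext (funext fun m => LinearMap.ext fun v => ?_))
    obtain ⟨d, hdF, rfl⟩ := hcomp v
    exact (hloc _ (a - b).2 d hdF).apply_eq_zero hd m _
  · intro v
    obtain ⟨d, hd, hv⟩ := hcomp v
    exact ⟨⟨d, hd⟩, hv⟩

end OPEA
end
end

section
/- Let 1∈E be an even vector that is invariant for an even pair 𝐓=(T,T̄) of operators on E (i.e. T1=T̄1=0). If an End(E)-valued distribution a(𝐳) is translation covariant for 𝐓 and weakly creative for 1, then a(𝐳) is creative for 1 and 𝐓, i.e. a(𝐳)1 = Σ_{𝐢=(i,ī)∈ℕ²} T^{(i)}T̄^{(ī)}(s_1 a(𝐳))·𝐳^𝐢. -/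
open scoped BigOperators Classical

noncomputable section

namespace OPEA

/-- A sequence on which an operator acts by `f (d i) = (i + 1) • d (i + 1)` is given by divided
powers of the operator applied to its initial term. -/
theorem eq_dividedPow_of_apply_eq_succ_smul {K E : Type*} [Field K] [CharZero K]
    [AddCommGroup E] [Module K E] (f : Module.End K E) (d : ℕ → E)
    (h : ∀ i, f (d i) = ((i : K) + 1) • d (i + 1)) (i : ℕ) :
    d i = (i.factorial : K)⁻¹ • (f ^ i) (d 0) := by
  induction i with
  | zero => simp
  | succ i ih =>
    have hi : (i : K) + 1 ≠ 0 := Nat.cast_add_one_ne_zero i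
    rw [← inv_smul_smul₀ hi (d (i + 1)), ← h i, ih, map_smul, smul_smul, pow_succ',
      Module.End.mul_apply, Nat.factorial_succ]
    push_cast
    rw [mul_inv]

theorem IsNegInt.exists_nat {K : Type*} [Field K] [CharZero K] {x : K} (h : IsNegInt K x) :
    ∃ i : ℕ, x = -(i : K) - 1 := by
  obtain ⟨k, hk, rfl⟩ := h
  obtain ⟨i, rfl⟩ : ∃ i : ℕ, k = -(i : ℤ) - 1 := ⟨(-k - 1).toNat, by omega⟩
  exact ⟨i, by push_cast; rfl⟩

/-- if 1 is invariant and a(𝐳) is translation covariant and weakly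
creative, then a(𝐳) is creative. -/
theorem stmt_19 (K : Type*) [Field K] [CharZero K]
    (E : Type*) [AddCommGroup E] [Module K E]
    (evE odE : Submodule K E) (hgr : IsCompl evE odE)
    (one : E) (hone : one ∈ evE)
    (T Tb : Module.End K E) (hT : EndPar K evE odE T 0) (hTb : EndPar K evE odE Tb 0)
    (hT1 : T one = 0) (hTb1 : Tb one = 0)
    (a : EDist1 K E)
    (htc : TransCov K E T Tb a)
    (hwc : IsPow1 K E (ev1 K E a one)) :
    CreativeD K E T Tb (ev1 K E a one) := by
  constructor
  · rintro ⟨i, j⟩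
    have hz (i : ℕ) : T (a (-(i : K) - 1, -(j : K) - 1) one) =
        ((i : K) + 1) • a (-((i + 1 : ℕ) : K) - 1, -(j : K) - 1) one := by
      have h := LinearMap.congr_fun (htc.1 (-(i : K) - 1, -(j : K) - 1)) one
      simp only [LinearMap.sub_apply, Module.End.mul_apply, hT1, map_zero, sub_zero,
        LinearMap.smul_apply] at h
      rw [h]
      push_cast
      ring_nf
    have hzb (j : ℕ) : Tb (a (-1, -(j : K) - 1) one) =
        ((j : K) + 1) • a (-1, -((j + 1 : ℕ) : K) - 1) one := by
      have h := LinearMap.congr_fun (htc.2 (-1, -(j : K) - 1)) one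
      simp only [LinearMap.sub_apply, Module.End.mul_apply, hTb1, map_zero, sub_zero,
        LinearMap.smul_apply] at h
      rw [h]
      push_cast
      ring_nf
    have h₁ := eq_dividedPow_of_apply_eq_succ_smul T
      (fun i : ℕ => a (-(i : K) - 1, -(j : K) - 1) one) hz i
    have h₂ := eq_dividedPow_of_apply_eq_succ_smul Tb
      (fun j : ℕ => a (-1, -(j : K) - 1) one) hzb j
    simp only [Nat.cast_zero, neg_zero, zero_sub] at h₁ h₂
    simp only [ev1]
    rw [h₁, h₂, map_smul, smul_smul, Module.End.mul_apply]
  · intro n hn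
    by_contra h
    obtain ⟨⟨i, hi⟩, ⟨j, hj⟩⟩ := (hwc n h).imp IsNegInt.exists_nat IsNegInt.exists_nat
    exact hn ⟨(i, j), Prod.ext hi hj⟩

end OPEA
end
end
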